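/- Let m be a positive integer and a an integer with a > m. Then ∑_{k=1}^{m} ψ₁(a+1-k)/k = -∑_{k=1}^{m} ψ₁(k+a-m)/k + (1/(a-m)²)·(ψ₀(a-m+1) - ψ₀(a+1) + ψ₀(m+1) - ψ₀(1)) + ψ₁(a+1)·(-ψ₀(a-m+1) + ψ₀(a+1) + ψ₀(m+1) - ψ₀(1)) + (1/(a-m))·(ψ₁(a+1) - ψ₁(a-m+1)) + (1/2)·( 2·(ψ₀(a-m+1) - ψ₀(a+1) + ψ₀(m+1) - ψ₀(1))·ψ₁(a-m+1) - ψ₂(a-m+1) + ψ₂(a+1) ). -/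

import Mathlib

open Finset

/-- Digamma function at a positive integer argument: `ψ₀ l = -γ + ∑_{i=1}^{l-1} 1/i`. -/
noncomputable def ψ₀ (l : ℕ) : ℝ :=
  -Real.eulerMascheroniConstant + ∑ i ∈ Finset.range (l - 1), (1 : ℝ) / (i + 1)

/-- Trigamma function at a positive integer argument: `ψ₁ l = π²/6 - ∑_{i=1}^{l-1} 1/i²`. -/
noncomputable def ψ₁ (l : ℕ) : ℝ :=
  Real.pi ^ 2 / 6 - ∑ i ∈ Finset.range (l - 1), (1 : ℝ) / (i + 1) ^ 2

/-- Tetragamma function at a positive integer argument: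
`ψ₂ l = -2ζ(3) + 2∑_{i=1}^{l-1} 1/i³`, where `ζ(3) = ∑_{i=1}^∞ 1/i³`. -/
noncomputable def ψ₂ (l : ℕ) : ℝ :=
  -2 * (∑' i : ℕ, (1 : ℝ) / (i + 1) ^ 3) +
    2 * ∑ i ∈ Finset.range (l - 1), (1 : ℝ) / (i + 1) ^ 3

lemma psi0_succ (l : ℕ) : ψ₀ (l + 1 + 1) = ψ₀ (l + 1) + 1 / ((l : ℝ) + 1) := by
  simp only [ψ₀, Nat.add_sub_cancel, Finset.sum_range_succ]; ring

lemma psi1_succ (l : ℕ) : ψ₁ (l + 1 + 1) = ψ₁ (l + 1) - 1 / ((l : ℝ) + 1) ^ 2 := by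
  simp only [ψ₁, Nat.add_sub_cancel, Finset.sum_range_succ]; ring

lemma psi2_succ (l : ℕ) : ψ₂ (l + 1 + 1) = ψ₂ (l + 1) + 2 / ((l : ℝ) + 1) ^ 3 := by
  simp only [ψ₂, Nat.add_sub_cancel, Finset.sum_range_succ]; ring

lemma psi0_sum (m : ℕ) : ∑ k ∈ range m, 1 / ((k : ℝ) + 1) = ψ₀ (m + 1) - ψ₀ 1 := by
  simp [ψ₀]

lemma psi0_refl (n m : ℕ) :
    ∑ k ∈ range m, 1 / ((n : ℝ) + m - k) = ψ₀ (n + m + 1) - ψ₀ (n + 1) := by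
  induction m with
  | zero => simp
  | succ m ih =>
    rw [Finset.sum_range_succ', ← add_assoc, psi0_succ,
      show ψ₀ (n + m + 1) = ∑ k ∈ range m, 1 / ((n : ℝ) + m - k) + ψ₀ (n + 1) by rw [ih]; ring]
    push_cast
    have : ∀ k : ℕ, (n : ℝ) + (m + 1) - (k + 1) = n + m - k := fun k => by ring
    simp only [this]
    ring

lemma psi1_refl (n m : ℕ) :
    ∑ k ∈ range m, 1 / ((n : ℝ) + m - k) ^ 2 = ψ₁ (n + 1) - ψ₁ (n + m + 1) := by
  induction m with
  | zero => simp
  | succ m ih =>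
    rw [Finset.sum_range_succ', ← add_assoc, psi1_succ,
      show ψ₁ (n + m + 1) = ψ₁ (n + 1) - ∑ k ∈ range m, 1 / ((n : ℝ) + m - k) ^ 2 by rw [ih]; ring]
    push_cast
    have : ∀ k : ℕ, (n : ℝ) + (m + 1) - (k + 1) = n + m - k := fun k => by ring
    simp only [this]
    ring

lemma pf_sum (n m : ℕ) :
    ∑ k ∈ range m, 1 / (((k : ℝ) + 1) * ((n : ℝ) + m - k) ^ 2) =
      1 / ((n : ℝ) + m + 1) ^ 2 *
        (ψ₀ (m + 1) - ψ₀ 1 + (ψ₀ (n + m + 1) - ψ₀ (n + 1))) +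
      1 / ((n : ℝ) + m + 1) * (ψ₁ (n + 1) - ψ₁ (n + m + 1)) := by
  rw [← psi0_sum, ← psi0_refl, ← psi1_refl, ← Finset.sum_add_distrib, Finset.mul_sum,
    Finset.mul_sum, ← Finset.sum_add_distrib]
  refine Finset.sum_congr rfl fun k hk => ?_
  have hk' : (k : ℝ) < m := by exact_mod_cast Finset.mem_range.1 hk
  have hn : (0 : ℝ) ≤ n := n.cast_nonneg
  have h1 : (k : ℝ) + 1 ≠ 0 := by positivity
  have h2 : (n : ℝ) + m + 1 ≠ 0 := by positivity
  have h3 : (n : ℝ) + m - k ≠ 0 := by linarith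
  field_simp
  ring

lemma first_succ (n m : ℕ) :
    ∑ k ∈ range (m + 1), ψ₁ (n + (m + 1) - k) / ((k : ℝ) + 1) =
      ∑ k ∈ range m, ψ₁ (n + m - k) / ((k : ℝ) + 1) -
        ∑ k ∈ range m, 1 / (((k : ℝ) + 1) * ((n : ℝ) + m - k) ^ 2) +
        ψ₁ (n + 1) / ((m : ℝ) + 1) := by
  rw [Finset.sum_range_succ, ← Finset.sum_sub_distrib, show n + (m + 1) - m = n + 1 by omega]
  congr 1
  refine Finset.sum_congr rfl fun k hk => ?_
  obtain ⟨j, rfl⟩ := Nat.exists_eq_add_of_lt (Finset.mem_range.1 hk)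
  rw [show n + (k + j + 1 + 1) - k = n + j + 1 + 1 by omega,
    show n + (k + j + 1) - k = n + j + 1 by omega, psi1_succ]
  push_cast
  rw [show (n : ℝ) + (k + j + 1) - k = n + j + 1 by ring]
  have h1 : (k : ℝ) + 1 ≠ 0 := by positivity
  have h3 : (n : ℝ) + j + 1 ≠ 0 := by positivity
  field_simp

lemma key (n m : ℕ) (hn : 0 < n) :
    ∑ k ∈ range m, ψ₁ (n + m - k) / ((k : ℝ) + 1) =
      -∑ k ∈ range m, ψ₁ (n + k + 1) / ((k : ℝ) + 1) +
        (1 / (n : ℝ) ^ 2) * (ψ₀ (n + 1) - ψ₀ (n + m + 1) + ψ₀ (m + 1) - ψ₀ 1) +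
        ψ₁ (n + m + 1) * (-ψ₀ (n + 1) + ψ₀ (n + m + 1) + ψ₀ (m + 1) - ψ₀ 1) +
        (1 / (n : ℝ)) * (ψ₁ (n + m + 1) - ψ₁ (n + 1)) +
        (1 / 2) * (2 * (ψ₀ (n + 1) - ψ₀ (n + m + 1) + ψ₀ (m + 1) - ψ₀ 1) *
            ψ₁ (n + 1) - ψ₂ (n + 1) + ψ₂ (n + m + 1)) := by
  induction m with
  | zero => simp
  | succ m ih =>
    rw [first_succ, ih, pf_sum, Finset.sum_range_succ, ← add_assoc n m 1, psi0_succ, psi0_succ,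
      psi1_succ, psi2_succ]
    push_cast
    have h0 : (n : ℝ) ≠ 0 := by positivity
    have h1 : (m : ℝ) + 1 ≠ 0 := by positivity
    have h2 : (n : ℝ) + m + 1 ≠ 0 := by positivity
    generalize ∑ k ∈ range m, ψ₁ (n + k + 1) / ((k : ℝ) + 1) = S
    field_simp
    ring

theorem stmt7 (m a : ℕ) (hm : 0 < m) (ha : m < a) :
    ∑ k ∈ Finset.Icc 1 m, ψ₁ (a + 1 - k) / (k : ℝ) =
      -∑ k ∈ Finset.Icc 1 m, ψ₁ (k + a - m) / (k : ℝ) +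
        (1 / ((a : ℝ) - m) ^ 2) *
          (ψ₀ (a - m + 1) - ψ₀ (a + 1) + ψ₀ (m + 1) - ψ₀ 1) +
        ψ₁ (a + 1) * (-ψ₀ (a - m + 1) + ψ₀ (a + 1) + ψ₀ (m + 1) - ψ₀ 1) +
        (1 / ((a : ℝ) - m)) * (ψ₁ (a + 1) - ψ₁ (a - m + 1)) +
        (1 / 2) * (2 * (ψ₀ (a - m + 1) - ψ₀ (a + 1) + ψ₀ (m + 1) - ψ₀ 1) *
            ψ₁ (a - m + 1) - ψ₂ (a - m + 1) + ψ₂ (a + 1)) := by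
  obtain ⟨n, rfl⟩ := Nat.exists_eq_add_of_le' ha.le
  have hn : 0 < n := by omega
  have h := key n m hn
  have e : ∀ f : ℕ → ℝ, ∑ k ∈ Finset.Icc 1 m, f k = ∑ k ∈ Finset.range m, f (k + 1) := by
    intro f
    clear h ha hm
    induction m with
    | zero => simp
    | succ m ih => rw [Finset.sum_Icc_succ_top (by omega), Finset.sum_range_succ, ih]
  rw [e, e, Nat.add_sub_cancel]
  have e1 : ∀ k, n + m + 1 - (k + 1) = n + m - k := fun k => by omega
  have e2 : ∀ k, k + 1 + (n + m) - m = n + k + 1 := fun k => by omega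
  simp only [e1, e2]
  push_cast
  rw [add_sub_cancel_right]
  exact h
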